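/- Let 0 ≤ x₀ < 𝔼[γ(X)·X], let 𝒢_ns be the set of measurable g : ℝ → ℝ with 𝔼[γ(X)·g(X)] ≥ x₀ and 0 ≤ g(X) ≤ X almost surely, and set q := inf{VaR_p(g(X)) : g ∈ 𝒢_ns}. Assume q > 0 and ℙ((X−q)·γ(X) ≤ VaR_p((X−q)·γ(X))) = p. Then, with c := VaR_p((X−q)·γ(X)), the minimization of VaR_p(g(X)) over 𝒢_ns admits a ℙ-almost surely unique solution, given by g*(X) = X·𝟙_{(X−q)γ(X) > c} + (X ∧ q)·𝟙_{(X−q)γ(X) ≤ c}. -/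

import Mathlib

open MeasureTheory Filter
open scoped ENNReal Topology Classical

noncomputable def VaR {Ω : Type*} [MeasurableSpace Ω] (P : Measure Ω) (p : ℝ) (Y : Ω → ℝ) : ℝ :=
  sInf {x : ℝ | p ≤ (P {ω | Y ω ≤ x}).toReal}

noncomputable def ES {Ω : Type*} [MeasurableSpace Ω] (P : Measure Ω) (p : ℝ) (Y : Ω → ℝ) : ℝ :=
  (1 - p)⁻¹ * ∫ u in p..(1 : ℝ), VaR P u Y

/-- The probability space is atomless. -/
def Atomless {Ω : Type*} [MeasurableSpace Ω] (P : Measure Ω) : Prop :=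
  ∀ s : Set Ω, MeasurableSet s → 0 < P s →
    ∃ t, t ⊆ s ∧ MeasurableSet t ∧ 0 < P t ∧ P t < P s

/-- The (topological) support of a measure on ℝ. -/
def msupport (μ : Measure ℝ) : Set ℝ :=
  {x | ∀ ε > 0, 0 < μ (Set.Ioo (x - ε) (x + ε))}

/-- The distribution `μ` has a density (w.r.t. Lebesgue measure) which is positive
on the support of `μ`. -/
def HasPositiveDensityOnSupport (μ : Measure ℝ) : Prop :=
  ∃ f : ℝ → ℝ, Measurable f ∧
    μ = MeasureTheory.volume.withDensity (fun x => ENNReal.ofReal (f x)) ∧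
    ∀ x ∈ msupport μ, 0 < f x

/-- The distribution `μ` has a density (w.r.t. Lebesgue measure) which is decreasing
(and positive) on the support of `μ`. -/
def HasDecreasingDensityOnSupport (μ : Measure ℝ) : Prop :=
  ∃ f : ℝ → ℝ, Measurable f ∧
    μ = MeasureTheory.volume.withDensity (fun x => ENNReal.ofReal (f x)) ∧
    AntitoneOn f (msupport μ) ∧ ∀ x ∈ msupport μ, 0 < f x

/-- Membership in the admissible set 𝒢_cm (complete market): measurable `g` with
budget constraint `𝔼[γ(X)·g(X)] ≥ x₀`. -/
def memGcm {Ω : Type*} [MeasurableSpace Ω] (P : Measure Ω) (X : Ω → ℝ) (γ : ℝ → ℝ)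
    (x₀ : ℝ) (g : ℝ → ℝ) : Prop :=
  Measurable g ∧ Integrable (fun ω => γ (X ω) * g (X ω)) P ∧
    x₀ ≤ ∫ ω, γ (X ω) * g (X ω) ∂P

/-- Membership in the admissible set 𝒢_ns (no short-selling):
`𝔼[γ(X)·g(X)] ≥ x₀` and `0 ≤ g(X) ≤ X` a.s. -/
def memGns {Ω : Type*} [MeasurableSpace Ω] (P : Measure Ω) (X : Ω → ℝ) (γ : ℝ → ℝ)
    (x₀ : ℝ) (g : ℝ → ℝ) : Prop :=
  Measurable g ∧ Integrable (fun ω => γ (X ω) * g (X ω)) P ∧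
    x₀ ≤ ∫ ω, γ (X ω) * g (X ω) ∂P ∧
    (∀ᵐ ω ∂P, 0 ≤ g (X ω) ∧ g (X ω) ≤ X ω)

/-- Membership in the admissible set 𝒢_bd (bounded positions):
`𝔼[γ(X)·g(X)] ≥ x₀` and `0 ≤ g(X) ≤ m` a.s. -/
def memGbd {Ω : Type*} [MeasurableSpace Ω] (P : Measure Ω) (X : Ω → ℝ) (γ : ℝ → ℝ)
    (x₀ m : ℝ) (g : ℝ → ℝ) : Prop :=
  Measurable g ∧ Integrable (fun ω => γ (X ω) * g (X ω)) P ∧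
    x₀ ≤ ∫ ω, γ (X ω) * g (X ω) ∂P ∧
    (∀ᵐ ω ∂P, 0 ≤ g (X ω) ∧ g (X ω) ≤ m)

section VaR

variable {Ω : Type*} [MeasurableSpace Ω] {P : Measure Ω}

lemma nonneg_of_pos_measureReal_le {Y : Ω → ℝ} (hY : ∀ᵐ ω ∂P, 0 ≤ Y ω) {p x : ℝ}
    (hp : 0 < p) (hx : p ≤ (P {ω | Y ω ≤ x}).toReal) : 0 ≤ x := by
  by_contra! hneg
  have h0 : P {ω | Y ω ≤ x} = 0 := by
    refine measure_mono_null (fun ω (hω : Y ω ≤ x) => ?_) (ae_iff.mp hY)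
    exact not_le.mpr (hω.trans_lt hneg)
  rw [h0, ENNReal.toReal_zero] at hx
  linarith

lemma VaR_nonneg {Y : Ω → ℝ} (hY : ∀ᵐ ω ∂P, 0 ≤ Y ω) {p : ℝ} (hp : 0 < p) :
    0 ≤ VaR P p Y :=
  Real.sInf_nonneg fun _ hx => nonneg_of_pos_measureReal_le hY hp hx

lemma VaR_le_of_le_measure {Y : Ω → ℝ} (hY : ∀ᵐ ω ∂P, 0 ≤ Y ω) {p x : ℝ} (hp : 0 < p)
    (hx : p ≤ (P {ω | Y ω ≤ x}).toReal) : VaR P p Y ≤ x :=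
  csInf_le ⟨0, fun _ hy => nonneg_of_pos_measureReal_le hY hp hy⟩ hx

/-- The infimum defining the quantile of a nonnegative random variable is attained. -/
lemma le_measure_le_VaR [IsProbabilityMeasure P] {Y : Ω → ℝ} (hYm : Measurable Y)
    {p : ℝ} (hp1 : p < 1) :
    p ≤ (P {ω | Y ω ≤ VaR P p Y}).toReal := by
  have : IsProbabilityMeasure (P.map Y) := Measure.isProbabilityMeasure_map hYm.aemeasurable
  have hcdf : ∀ x, (P {ω | Y ω ≤ x}).toReal = ProbabilityTheory.cdf (P.map Y) x := by
    intro x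
    rw [ProbabilityTheory.cdf_eq_real, Measure.real, Measure.map_apply hYm measurableSet_Iic]
    rfl
  have hne : {x : ℝ | p ≤ (P {ω | Y ω ≤ x}).toReal}.Nonempty := by
    obtain ⟨x, hx⟩ := ((ProbabilityTheory.tendsto_cdf_atTop (P.map Y)).eventually
      (lt_mem_nhds hp1)).exists
    exact ⟨x, by rw [Set.mem_ofPred_eq, hcdf]; exact hx.le⟩
  have hright := ((ProbabilityTheory.cdf (P.map Y)).right_continuous (VaR P p Y)).tendsto.mono_left
    (nhdsWithin_mono _ Set.Ioi_subset_Ici_self)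
  rw [hcdf]
  refine ge_of_tendsto hright ?_
  filter_upwards [self_mem_nhdsWithin] with x hx
  obtain ⟨s, hs, hsx⟩ := exists_lt_of_csInf_lt hne hx
  rw [Set.mem_ofPred_eq, hcdf] at hs
  exact hs.trans (ProbabilityTheory.monotone_cdf _ hsx.le)

/-- Neyman–Pearson: among events at least as likely as a sublevel event `B` of `Z`, the event `B`
minimizes the integral of `Z`; the minimizer is unique if the level is positive. -/
lemma setIntegral_le_of_sublevel [IsFiniteMeasure P] {Z : Ω → ℝ} (hZ : Integrable Z P) {k : ℝ}
    (hk : 0 ≤ k) {A B : Set Ω} (hA : MeasurableSet A) (hB : MeasurableSet B)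
    (hle : ∀ ω ∈ B, Z ω ≤ k) (hge : ∀ ω ∉ B, k ≤ Z ω) (hBA : P.real B ≤ P.real A) :
    ∫ ω in B, Z ω ∂P ≤ ∫ ω in A, Z ω ∂P ∧
      (0 < k → (∀ ω ∉ B, k < Z ω) → ∫ ω in A, Z ω ∂P ≤ ∫ ω in B, Z ω ∂P → A =ᵐ[P] B) := by
  set V : Ω → ℝ := fun ω => Z ω - k
  have hV : Integrable V P := hZ.sub (integrable_const k)
  set φ : Ω → ℝ := fun ω => A.indicator V ω - B.indicator V ω
  have hφ : ∀ ω, 0 ≤ φ ω := by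
    intro ω
    by_cases h1 : ω ∈ A <;> by_cases h2 : ω ∈ B <;> simp only [φ, V, h1, h2,
      Set.indicator_of_mem, Set.indicator_of_notMem, not_false_eq_true]
    · simp
    · linarith [hge ω h2]
    · linarith [hle ω h2]
    · simp
  have hφi : Integrable φ P := (hV.indicator hA).sub (hV.indicator hB)
  have hset : ∀ S, MeasurableSet S →
      ∫ ω, S.indicator V ω ∂P = ∫ ω in S, Z ω ∂P - k * P.real S := by
    intro S hS
    rw [integral_indicator hS]
    simp only [V]
    rw [integral_sub hZ.integrableOn (integrable_const k).integrableOn, setIntegral_const,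
      smul_eq_mul, mul_comm k]
  have hφint : ∫ ω, φ ω ∂P = (∫ ω in A, Z ω ∂P - k * P.real A)
      - (∫ ω in B, Z ω ∂P - k * P.real B) := by
    rw [← hset A hA, ← hset B hB]
    exact integral_sub (hV.indicator hA) (hV.indicator hB)
  have hφ0 : 0 ≤ ∫ ω, φ ω ∂P := integral_nonneg hφ
  have hkm : k * P.real B ≤ k * P.real A := mul_le_mul_of_nonneg_left hBA hk
  refine ⟨by linarith, fun hkpos hgt heq => ?_⟩
  have hzero : ∫ ω, φ ω ∂P = 0 := by linarith
  have hreal : P.real A ≤ P.real B := le_of_mul_le_mul_left (by linarith) hkpos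
  have hae := (integral_eq_zero_iff_of_nonneg hφ hφi).mp hzero
  have hsub : A ≤ᵐ[P] B := by
    filter_upwards [hae] with ω hω hωA
    by_contra hωB
    have hωA' : ω ∈ A := hωA
    have hωB' : ω ∉ B := hωB
    simp only [φ, V, hωA', hωB', Set.indicator_of_mem, Set.indicator_of_notMem,
      not_false_eq_true, Pi.zero_apply] at hω
    linarith [hgt ω hωB]
  refine ae_eq_of_ae_subset_of_measure_ge hsub ?_ hA.nullMeasurableSet (measure_ne_top P B)
  exact (ENNReal.toReal_le_toReal (measure_ne_top P B) (measure_ne_top P A)).mp hBA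

end VaR

section NoShortSelling

variable {Ω : Type*} [MeasurableSpace Ω] {P : Measure Ω} {X : Ω → ℝ} {γ : ℝ → ℝ} {x₀ : ℝ}

lemma memGns.setIntegral_le {g : ℝ → ℝ} (hg : memGns P X γ x₀ g) (hX : Measurable X)
    (hγ : ∀ x, 0 < γ x) (hγint : Integrable (fun ω => γ (X ω)) P)
    (hγX : Integrable (fun ω => γ (X ω) * X ω) P) (v : ℝ) :
    ∫ ω in {ω | g (X ω) ≤ v}, max ((X ω - v) * γ (X ω)) 0 ∂P ≤
      ∫ ω, γ (X ω) * X ω ∂P - ∫ ω, γ (X ω) * g (X ω) ∂P := by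
  obtain ⟨hgm, hgi, -, hgb⟩ := hg
  have hA : MeasurableSet {ω | g (X ω) ≤ v} := measurableSet_le (hgm.comp hX) measurable_const
  have hZ : Integrable (fun ω => max ((X ω - v) * γ (X ω)) 0) P := by
    refine Integrable.pos_part ((hγX.sub (hγint.const_mul v)).congr (ae_of_all _ fun ω => ?_))
    simp only [Pi.sub_apply]
    ring
  rw [← integral_sub hγX hgi, ← integral_indicator hA]
  refine integral_mono_ae (hZ.indicator hA) (hγX.sub hgi) ?_
  filter_upwards [hgb] with ω hω
  have h0 := mul_nonneg (hγ (X ω)).le (sub_nonneg.mpr hω.2)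
  by_cases h : ω ∈ {ω | g (X ω) ≤ v}
  · rw [Set.indicator_of_mem h]
    have h' : g (X ω) ≤ v := h
    refine max_le ?_ (by linarith)
    nlinarith [hγ (X ω)]
  · rw [Set.indicator_of_notMem h]
    linarith

/-- If the budget constraint were slack, scaling the position down would lower the quantile. -/
lemma memGns.budget_binding {g : ℝ → ℝ} (hg : memGns P X γ x₀ g) {p q : ℝ}
    (hp : 0 < p) (hq : 0 < q)
    (hmin : ∀ f : ℝ → ℝ, memGns P X γ x₀ f → q ≤ VaR P p (fun ω => f (X ω)))
    (hgq : p ≤ (P {ω | g (X ω) ≤ q}).toReal) :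
    ∫ ω, γ (X ω) * g (X ω) ∂P = x₀ := by
  obtain ⟨hgm, hgi, hgx, hgb⟩ := hg
  refine le_antisymm ?_ hgx
  by_contra! hlt
  have hcont : Tendsto (fun t : ℝ => t * ∫ ω, γ (X ω) * g (X ω) ∂P) (𝓝[<] 1)
      (𝓝 (1 * ∫ ω, γ (X ω) * g (X ω) ∂P)) :=
    (Continuous.tendsto (by fun_prop) 1).mono_left nhdsWithin_le_nhds
  rw [one_mul] at hcont
  obtain ⟨t, ht, ht0, ht1⟩ := ((hcont.eventually (lt_mem_nhds hlt)).and
    (Ioo_mem_nhdsLT (zero_lt_one' ℝ))).exists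
  have hfun : (fun ω => γ (X ω) * (t * g (X ω))) = fun ω => t * (γ (X ω) * g (X ω)) := by
    ext ω; ring
  have hf : memGns P X γ x₀ (fun x => t * g x) := by
    refine ⟨hgm.const_mul t, ?_, ?_, ?_⟩
    · simp only [hfun]
      exact hgi.const_mul t
    · simp only [hfun]
      rw [integral_const_mul]
      exact ht.le
    · filter_upwards [hgb] with ω hω
      exact ⟨mul_nonneg ht0.le hω.1, by nlinarith⟩
  have hle : VaR P p (fun ω => t * g (X ω)) ≤ t * q := by
    refine VaR_le_of_le_measure (hf.2.2.2.mono fun ω hω => hω.1) hp ?_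
    simpa only [mul_le_mul_iff_right₀ ht0] using hgq
  nlinarith [hmin _ hf]

end NoShortSelling

theorem stmt5 {Ω : Type*} [MeasurableSpace Ω] (P : Measure Ω) [IsProbabilityMeasure P]
    (hPatomless : Atomless P)
    (X : Ω → ℝ) (hXmeas : Measurable X) (hXnonneg : ∀ᵐ ω ∂P, 0 ≤ X ω)
    (hXdens : HasPositiveDensityOnSupport (Measure.map X P))
    (γ : ℝ → ℝ) (hγcont : Continuous γ) (hγpos : ∀ x, 0 < γ x)
    (hγint : Integrable (fun ω => γ (X ω)) P)
    (hγ1 : ∫ ω, γ (X ω) ∂P = 1)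
    (hγXint : Integrable (fun ω => γ (X ω) * X ω) P)
    (p : ℝ) (hp : p ∈ Set.Ioo (0 : ℝ) 1)
    (x₀ : ℝ) (hx₀ : 0 ≤ x₀) (hx₀lt : x₀ < ∫ ω, γ (X ω) * X ω ∂P)
    (q : ℝ)
    (hq : q = sInf {v : ℝ | ∃ g : ℝ → ℝ, memGns P X γ x₀ g ∧ v = VaR P p (fun ω => g (X ω))})
    (hqpos : 0 < q)
    (c : ℝ) (hc : c = VaR P p (fun ω => (X ω - q) * γ (X ω)))
    (hcont : (P {ω | (X ω - q) * γ (X ω) ≤ c}).toReal = p) :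
    ∃ g : ℝ → ℝ, memGns P X γ x₀ g ∧ VaR P p (fun ω => g (X ω)) = q ∧
      (∀ᵐ ω ∂P, g (X ω) = if c < (X ω - q) * γ (X ω) then X ω else min (X ω) q) ∧
      ∀ h : ℝ → ℝ, memGns P X γ x₀ h → VaR P p (fun ω => h (X ω)) = q →
        ∀ᵐ ω ∂P, h (X ω) = g (X ω) := by
  have hγXm : Measurable fun ω => γ (X ω) := hγcont.measurable.comp hXmeas
  have hnn : ∀ f : ℝ → ℝ, memGns P X γ x₀ f → 0 ≤ VaR P p (fun ω => f (X ω)) :=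
    fun f hf => VaR_nonneg (hf.2.2.2.mono fun ω hω => hω.1) hp.1
  have hmin : ∀ f : ℝ → ℝ, memGns P X γ x₀ f → q ≤ VaR P p (fun ω => f (X ω)) := by
    intro f hf
    rw [hq]
    exact csInf_le ⟨0, by rintro v ⟨g, hg, rfl⟩; exact hnn g hg⟩ ⟨f, hf, rfl⟩
  set W : Ω → ℝ := fun ω => (X ω - q) * γ (X ω)
  set B : Set Ω := {ω | W ω ≤ c}
  have hWm : Measurable W := (hXmeas.sub_const q).mul hγXm
  have hB : MeasurableSet B := measurableSet_le hWm measurable_const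
  have hWi : Integrable W P := by
    refine (hγXint.sub (hγint.const_mul q)).congr (ae_of_all _ fun ω => ?_)
    simp only [Pi.sub_apply, W]
    ring
  have hZ : Integrable (fun ω => max (W ω) 0) P := hWi.pos_part
  have hNP : ∀ A, MeasurableSet A → p ≤ (P A).toReal →
      ∫ ω in B, max (W ω) 0 ∂P ≤ ∫ ω in A, max (W ω) 0 ∂P ∧
      (0 < max c 0 → (∀ ω ∉ B, max c 0 < max (W ω) 0) →
        ∫ ω in A, max (W ω) 0 ∂P ≤ ∫ ω in B, max (W ω) 0 ∂P → A =ᵐ[P] B) := by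
    intro A hA hpA
    refine setIntegral_le_of_sublevel hZ (le_max_right c 0) hA hB
      (fun ω hω => max_le_max_right 0 hω) (fun ω hω => max_le_max_right 0 (not_le.mp hω).le) ?_
    exact hcont.le.trans hpA
  set g : ℝ → ℝ := fun x => if c < (x - q) * γ x then x else min x q
  have hgm : Measurable g := by
    refine Measurable.ite (measurableSet_lt measurable_const
      ((measurable_id.sub_const q).mul hγcont.measurable)) measurable_id ?_
    exact measurable_id.min measurable_const
  have hgpt : ∀ ω, γ (X ω) * g (X ω) = γ (X ω) * X ω - B.indicator (fun ω => max (W ω) 0) ω := by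
    intro ω
    by_cases h : ω ∈ B
    · have h' : ¬ c < (X ω - q) * γ (X ω) := not_lt.mpr h
      rw [Set.indicator_of_mem h]
      simp only [g, h', if_false, W]
      rcases le_total (X ω) q with hx | hx
      · rw [min_eq_left hx, max_eq_right
          (mul_nonpos_of_nonpos_of_nonneg (by linarith) (hγpos _).le)]
        ring
      · rw [min_eq_right hx, max_eq_left (mul_nonneg (by linarith) (hγpos _).le)]
        ring
    · have h' : c < (X ω - q) * γ (X ω) := not_le.mp h
      rw [Set.indicator_of_notMem h]
      simp only [g, h', if_true, sub_zero]
  have hgi : Integrable (fun ω => γ (X ω) * g (X ω)) P := by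
    simp only [hgpt]
    exact hγXint.sub (hZ.indicator hB)
  have hgint : ∫ ω, γ (X ω) * g (X ω) ∂P =
      ∫ ω, γ (X ω) * X ω ∂P - ∫ ω in B, max (W ω) 0 ∂P := by
    simp only [hgpt]
    rw [integral_sub hγXint (hZ.indicator hB), integral_indicator hB]
  have hbudget : x₀ ≤ ∫ ω, γ (X ω) * g (X ω) ∂P := by
    rw [hgint]
    suffices h : ∀ ε > 0, ∫ ω in B, max (W ω) 0 ∂P ≤ (∫ ω, γ (X ω) * X ω ∂P - x₀) + ε by
      linarith [le_of_forall_pos_le_add h]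
    intro ε hε
    have hne : {v : ℝ | ∃ g : ℝ → ℝ, memGns P X γ x₀ g ∧
        v = VaR P p (fun ω => g (X ω))}.Nonempty := by
      by_contra hempty
      rw [Set.not_nonempty_iff_eq_empty.mp hempty, Real.sInf_empty] at hq
      linarith
    obtain ⟨v, ⟨f, hf, hvf⟩, hvlt⟩ := exists_lt_of_csInf_lt hne
      (show sInf _ < q + ε by rw [← hq]; linarith)
    have hqv : q ≤ v := hvf ▸ hmin f hf
    have hA : MeasurableSet {ω | f (X ω) ≤ v} :=
      measurableSet_le (hf.1.comp hXmeas) measurable_const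
    have hpA : p ≤ (P {ω | f (X ω) ≤ v}).toReal := by
      rw [hvf]
      exact le_measure_le_VaR (hf.1.comp hXmeas) hp.2
    have h1 := (hNP _ hA hpA).1
    have h2 := hf.setIntegral_le hXmeas hγpos hγint hγXint v
    have hZv : Integrable (fun ω => max ((X ω - v) * γ (X ω)) 0) P := by
      refine Integrable.pos_part ((hγXint.sub (hγint.const_mul v)).congr
        (ae_of_all _ fun ω => ?_))
      simp only [Pi.sub_apply]
      ring
    have h3 : ∫ ω in {ω | f (X ω) ≤ v}, max (W ω) 0 ∂P ≤
        ∫ ω in {ω | f (X ω) ≤ v}, (max ((X ω - v) * γ (X ω)) 0 + (v - q) * γ (X ω)) ∂P := by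
      refine setIntegral_mono hZ.integrableOn
        (hZv.add (hγint.const_mul (v - q))).integrableOn fun ω => ?_
      have hm := mul_nonneg (sub_nonneg.mpr hqv) (hγpos (X ω)).le
      refine max_le ?_ (add_nonneg (le_max_right _ _) hm)
      have := le_max_left ((X ω - v) * γ (X ω)) 0
      simp only [W]
      linarith
    rw [integral_add hZv.integrableOn (hγint.const_mul (v - q)).integrableOn] at h3
    have h4 : ∫ ω in {ω | f (X ω) ≤ v}, (v - q) * γ (X ω) ∂P ≤ v - q := by
      refine (setIntegral_le_integral (hγint.const_mul (v - q)) (ae_of_all _ fun ω =>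
        mul_nonneg (sub_nonneg.mpr hqv) (hγpos (X ω)).le)).trans ?_
      rw [integral_const_mul, hγ1, mul_one]
    linarith [hf.2.2.1]
  have hg : memGns P X γ x₀ g := by
    refine ⟨hgm, hgi, hbudget, ?_⟩
    filter_upwards [hXnonneg] with ω hω
    by_cases h : c < (X ω - q) * γ (X ω)
    · simp only [g, h, if_true]
      exact ⟨hω, le_rfl⟩
    · simp only [g, h, if_false]
      exact ⟨le_min hω hqpos.le, min_le_left _ _⟩
  have hgq : p ≤ (P {ω | g (X ω) ≤ q}).toReal := by
    rw [← hcont]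
    refine ENNReal.toReal_mono (measure_ne_top _ _) (measure_mono fun ω hω => ?_)
    have h' : ¬ c < (X ω - q) * γ (X ω) := not_lt.mpr hω
    simp only [Set.mem_ofPred_eq, g, h', if_false]
    exact min_le_right _ _
  have hgx₀ := hg.budget_binding hp.1 hqpos hmin hgq
  have hcpos : 0 < c := by
    by_contra! hc0
    have hzero : ∫ ω in B, max (W ω) 0 ∂P = 0 := by
      rw [setIntegral_congr_fun hB (g := fun _ => (0 : ℝ))
        fun ω hω => max_eq_right (le_trans hω hc0)]
      simp
    linarith
  refine ⟨g, hg, le_antisymm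
    (VaR_le_of_le_measure (hg.2.2.2.mono fun ω hω => hω.1) hp.1 hgq) (hmin g hg),
    ae_of_all _ fun ω => rfl, fun h hh hhq => ?_⟩
  have hA : MeasurableSet {ω | h (X ω) ≤ q} :=
    measurableSet_le (hh.1.comp hXmeas) measurable_const
  have hpA : p ≤ (P {ω | h (X ω) ≤ q}).toReal := by
    have hle := le_measure_le_VaR (P := P) (Y := fun ω => h (X ω)) (hh.1.comp hXmeas) hp.2
    rwa [hhq] at hle
  have hhx₀ := hh.budget_binding hp.1 hqpos hmin hpA
  have hAB : {ω | h (X ω) ≤ q} =ᵐ[P] B := by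
    refine (hNP _ hA hpA).2 (lt_max_of_lt_left hcpos) (fun ω hω => ?_) ?_
    · have hω' : c < W ω := not_le.mp hω
      rw [max_eq_left hcpos.le]
      exact lt_max_of_lt_left hω'
    · linarith [hh.setIntegral_le hXmeas hγpos hγint hγXint q]
  have hle : ∀ᵐ ω ∂P, h (X ω) ≤ g (X ω) := by
    filter_upwards [hAB.mem_iff, hh.2.2.2] with ω hω hb
    by_cases hωB : ω ∈ B
    · have h' : ¬ c < (X ω - q) * γ (X ω) := not_lt.mpr hωB
      simp only [g, h', if_false]
      exact le_min hb.2 (hω.mpr hωB)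
    · have h' : c < (X ω - q) * γ (X ω) := not_le.mp hωB
      simp only [g, h', if_true]
      exact hb.2
  have heq := (integral_eq_iff_of_ae_le hh.2.1 hgi (hle.mono fun ω hω =>
    mul_le_mul_of_nonneg_left hω (hγpos (X ω)).le)).mp (hhx₀.trans hgx₀.symm)
  filter_upwards [heq] with ω hω
  exact mul_left_cancel₀ (hγpos (X ω)).ne' hω
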